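/- arXiv:1910.04246 — 2 statements merged into one kernel-verified Lean document; each statement's English description precedes it below -/
import Mathlib

section
/- Let C be a finitely generated free S-module (S = F[ε] the dual numbers over F = ℤ/2) and let d : C → C be an S-linear map with d ∘ d = 0. Then the unrolled complex of (C, d) is acyclic: the unrolled differential ∂ on K ⊗_F C satisfies ∂ ∘ ∂ = 0 and ker ∂ = im ∂. -/
open TensorProduct

/- Instance priority tweak so that the various module structures on Laurent series
over `F = ℤ/2` are found consistently. -/
attribute [local instance 2000] Algebra.toModule

theorem LaurentSeries.transcendental_single_one (F : Type*) [Field F] :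
    Transcendental F (HahnSeries.single 1 1 : LaurentSeries F) := by
  have aeval_eq (p : Polynomial F) :
      Polynomial.aeval (HahnSeries.single 1 1 : LaurentSeries F) p =
        HahnSeries.ofPowerSeries ℤ F p := by
    induction p using Polynomial.induction_on with
    | C a => simp [HahnSeries.algebraMap_apply']
    | add p q hp hq => simp [hp, hq]
    | monomial n a _ =>
      simp [HahnSeries.algebraMap_apply', HahnSeries.C_apply]
  rw [transcendental_iff]
  intro p hp
  rw [aeval_eq, map_eq_zero_iff _ HahnSeries.ofPowerSeries_injective] at hp
  exact_mod_cast hp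

theorem DualNumber.exists_contraction_eps (F C : Type*) [Field F] [AddCommGroup C] [Module F C]
    [Module (DualNumber F) C] [IsScalarTower F (DualNumber F) C]
    [Module.Free (DualNumber F) C] :
    ∃ s : C →ₗ[F] C, ∀ z : C,
      (DualNumber.eps : DualNumber F) • s z + s ((DualNumber.eps : DualNumber F) • z) = z := by
  let b := Module.Free.chooseBasis (DualNumber F) C
  let r : C ≃ₗ[F] (_ →₀ DualNumber F) := b.repr.restrictScalars F
  let t : DualNumber F →ₗ[F] DualNumber F :=
    (TrivSqZeroExt.inlAlgHom F F F).toLinearMap ∘ₗ TrivSqZeroExt.sndHom F F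
  have ht (a : DualNumber F) : DualNumber.eps * t a + t (DualNumber.eps * a) = a := by
    ext <;> simp [t]
  refine ⟨r.symm.toLinearMap ∘ₗ Finsupp.mapRange.linearMap t ∘ₗ r.toLinearMap, fun z ↦ ?_⟩
  apply b.repr.injective
  ext1 i
  simpa [r] using ht (b.repr z i)

theorem DualNumber.finite_of_finite (F C : Type*) [Field F] [AddCommGroup C] [Module F C]
    [Module (DualNumber F) C] [IsScalarTower F (DualNumber F) C]
    [Module.Finite (DualNumber F) C] : Module.Finite F C := by
  have : Module.Finite F (DualNumber F) := inferInstanceAs (Module.Finite F (F × F))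
  exact Module.Finite.trans (DualNumber F) C

theorem Module.End.isUnit_baseChange_sub_algebraMap {F K V : Type*} [Field F] [Field K]
    [Algebra F K] [AddCommGroup V] [Module F V] [Module.Finite F V] (T : Module.End F V) {μ : K}
    (hμ : Transcendental F μ) :
    IsUnit (LinearMap.baseChange K T - algebraMap K (Module.End K (K ⊗[F] V)) μ) := by
  by_contra h
  have hev : Module.End.HasEigenvalue (LinearMap.baseChange K T) μ := by
    rwa [Module.End.hasEigenvalue_iff_mem_spectrum, spectrum.mem_iff, IsUnit.sub_iff]
  refine hμ ⟨LinearMap.charpoly T, (LinearMap.charpoly_monic T).ne_zero, ?_⟩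
  have := (Module.End.hasEigenvalue_iff_isRoot_charpoly _ _).mp hev
  rwa [LinearMap.charpoly_baseChange, Polynomial.IsRoot, Polynomial.eval_map_algebraMap] at this

/-- A square-zero endomorphism which is contractible up to an invertible endomorphism is exact. -/
theorem LinearMap.ker_eq_range_of_isUnit_homotopy {R V : Type*} [Ring R] [AddCommGroup V]
    [Module R V] {D s : Module.End R V} (hD : D * D = 0) (h : IsUnit (D * s + s * D)) :
    LinearMap.ker D = LinearMap.range D := by
  obtain ⟨u, hu⟩ := h
  have hcomm : Commute D u := by
    rw [hu, commute_iff_eq, mul_add, add_mul, ← mul_assoc, mul_assoc s, hD, mul_assoc]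
    simp
  refine le_antisymm (fun z hz ↦ ?_) ?_
  · refine ⟨(↑u⁻¹ : Module.End R V) (s z), ?_⟩
    have huz : (u : Module.End R V) z = D (s z) := by
      simp [hu, LinearMap.mem_ker.mp hz]
    calc D ((↑u⁻¹ : Module.End R V) (s z))
        = (D * ↑u⁻¹) (s z) := rfl
      _ = (↑u⁻¹ * D : Module.End R V) (s z) := by rw [hcomm.units_inv_right.eq]
      _ = (↑u⁻¹ * ↑u : Module.End R V) z := by simp only [Module.End.mul_apply, huz]
      _ = z := by simp
  · rintro _ ⟨z, rfl⟩
    exact LinearMap.congr_fun hD z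

/-- **The unrolled complex of a finitely generated free differential module over the dual
numbers is acyclic.**  Here `F = ℤ/2`, `S = F[ε]` the dual numbers, `K = LaurentSeries F`,
and the unrolled differential `∂` on `K ⊗[F] C` is determined by
`∂(f ⊗ z) = f ⊗ d(z) + (x·f) ⊗ (ε·z)`, where `x` is the Laurent series variable.
If `C` is a finitely generated free `S`-module and `d : C → C` is `S`-linear with `d ∘ d = 0`,
then `∂ ∘ ∂ = 0` and `ker ∂ = im ∂`. -/
theorem unrolled_complex_of_free_is_acyclic
    (C : Type) [AddCommGroup C] [Module (ZMod 2) C]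
    [Module (DualNumber (ZMod 2)) C] [IsScalarTower (ZMod 2) (DualNumber (ZMod 2)) C]
    [Module.Free (DualNumber (ZMod 2)) C] [Module.Finite (DualNumber (ZMod 2)) C]
    (d : C →ₗ[DualNumber (ZMod 2)] C) (hd : d ∘ₗ d = 0)
    (D : (LaurentSeries (ZMod 2) ⊗[ZMod 2] C) →ₗ[LaurentSeries (ZMod 2)]
      (LaurentSeries (ZMod 2) ⊗[ZMod 2] C))
    (hD : ∀ (f : LaurentSeries (ZMod 2)) (z : C),
      D (f ⊗ₜ[ZMod 2] z) = f ⊗ₜ[ZMod 2] (d z) +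
        ((HahnSeries.single 1 1 : LaurentSeries (ZMod 2)) * f) ⊗ₜ[ZMod 2]
          ((DualNumber.eps : DualNumber (ZMod 2)) • z)) :
    D ∘ₗ D = 0 ∧ LinearMap.ker D = LinearMap.range D := by
  have : Module.Finite (ZMod 2) C := DualNumber.finite_of_finite (ZMod 2) C
  have : CharP (LaurentSeries (ZMod 2)) 2 :=
    charP_of_injective_algebraMap (algebraMap (ZMod 2) (LaurentSeries (ZMod 2))).injective 2
  have add_self (v : LaurentSeries (ZMod 2) ⊗[ZMod 2] C) : v + v = 0 := by
    simpa [CharTwo.add_self_eq_zero] using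
      (add_smul (1 : LaurentSeries (ZMod 2)) 1 v).symm
  have hdd (z : C) : d (d z) = 0 := LinearMap.congr_fun hd z
  have hDD : D * D = 0 := by
    ext z
    simp [hD, hdd, smul_smul, add_self]
  refine ⟨hDD, ?_⟩
  obtain ⟨s, hs⟩ := DualNumber.exists_contraction_eps (ZMod 2) C
  let d₀ : C →ₗ[ZMod 2] C := d.restrictScalars (ZMod 2)
  refine LinearMap.ker_eq_range_of_isUnit_homotopy
    (s := s.baseChange (LaurentSeries (ZMod 2))) hDD ?_
  convert Module.End.isUnit_baseChange_sub_algebraMap (d₀ * s + s * d₀)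
    (LaurentSeries.transcendental_single_one (ZMod 2)) using 1
  ext z
  have hz := congrArg ((HahnSeries.single 1 1 : LaurentSeries (ZMod 2)) ⊗ₜ[ZMod 2] ·) (hs z)
  simp only [TensorProduct.tmul_add] at hz
  have hx : (HahnSeries.single 1 1 : LaurentSeries (ZMod 2)) •
      ((1 : LaurentSeries (ZMod 2)) ⊗ₜ[ZMod 2] z) =
        (HahnSeries.single 1 1 : LaurentSeries (ZMod 2)) ⊗ₜ[ZMod 2] z := by
    rw [TensorProduct.smul_tmul', smul_eq_mul, mul_one]
  simp [hD, d₀, hx, sub_eq_add_neg,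
    neg_eq_of_add_eq_zero_left (add_self _), ← hz]
  abel
end

section
/- Let M be an S-module (S = F[ε] the dual numbers over F = ℤ/2) that is finite-dimensional as an F-vector space, regarded as a differential S-module with zero differential d = 0, so that the unrolled differential on K ⊗_F M is ∂(f ⊗ m) = (x·f) ⊗ (ε·m). Then the unrolled homology ker ∂ / im ∂ is a K-vector space of dimension dim_F(M) − 2·dim_F(ε·M), where ε·M denotes the image of the action of ε on M. In particular, the unrolled complex of (M, 0) is acyclic if and only if dim_F(M) = 2·dim_F(ε·M). -/
open TensorProduct

instance : SMulCommClass (ZMod 2) (LaurentSeries (ZMod 2)) (LaurentSeries (ZMod 2)) :=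
  ⟨fun r a b => by
    have h : r = 0 ∨ r = 1 := by revert r; decide
    rcases h with h | h <;> subst h <;> simp⟩

namespace LinearMap

variable {F K : Type*} [Field F] [Field K] [Algebra F K]
  {V : Type*} [AddCommGroup V] [Module F V]

/-- The rank of a linear map is invariant under extension of scalars. -/
theorem finrank_range_baseChange (e : V →ₗ[F] V) :
    Module.finrank K (range (e.baseChange K)) = Module.finrank F (range e) := by
  have hsurj : range (e.rangeRestrict.baseChange K) = ⊤ :=
    range_eq_top.2 (lTensor_surjective K e.surjective_rangeRestrict)
  have hinj : Function.Injective ((range e).subtype.baseChange K) :=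
    Module.Flat.lTensor_preserves_injective_linearMap _ (range e).injective_subtype
  have hcomp : e.baseChange K =
      (range e).subtype.baseChange K ∘ₗ e.rangeRestrict.baseChange K := by
    rw [← baseChange_comp, subtype_comp_codRestrict]
  rw [hcomp, range_comp_of_range_eq_top _ hsurj, finrank_range_of_inj hinj,
    Module.finrank_baseChange]

/-- The rank of a linear map on `K ⊗[F] V` of the form `f ⊗ v ↦ (x * f) ⊗ e v`. -/
theorem finrank_range_of_tmul {x : K} (hx : x ≠ 0) (e : V →ₗ[F] V)
    (D : K ⊗[F] V →ₗ[K] K ⊗[F] V) (hD : ∀ f v, D (f ⊗ₜ[F] v) = (x * f) ⊗ₜ[F] e v) :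
    Module.finrank K (range D) = Module.finrank F (range e) := by
  have h : D = x • e.baseChange K := by
    ext v
    simp [hD, smul_tmul']
  rw [h, range_smul _ _ hx, finrank_range_baseChange]

theorem range_le_ker_of_tmul (x : K) {e : V →ₗ[F] V} (he : ∀ v, e (e v) = 0)
    (D : K ⊗[F] V →ₗ[K] K ⊗[F] V) (hD : ∀ f v, D (f ⊗ₜ[F] v) = (x * f) ⊗ₜ[F] e v) :
    range D ≤ ker D := by
  rw [range_le_ker_iff]
  ext v
  simp [hD, he]

section Homology

variable {W : Type*} [AddCommGroup W] [Module K W] [Module.Finite K W] {D : W →ₗ[K] W}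

/-- The dimension of the homology of a differential vector space. -/
theorem finrank_homology (h : range D ≤ ker D)
    {H : Type*} [AddCommGroup H] [Module K H] (π : ker D →ₗ[K] H)
    (hπ : Function.Surjective π) (hker : ker π = (range D).comap (ker D).subtype) :
    Module.finrank K H = Module.finrank K W - 2 * Module.finrank K (range D) := by
  have h₁ := D.finrank_range_add_finrank_ker
  have h₂ := π.finrank_range_add_finrank_ker
  rw [range_eq_top.2 hπ, finrank_top, hker,
    (Submodule.comapSubtypeEquivOfLe h).finrank_eq] at h₂
  omega

theorem ker_eq_range_iff_finrank_eq (h : range D ≤ ker D) :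
    ker D = range D ↔ Module.finrank K W = 2 * Module.finrank K (range D) := by
  have h₁ := D.finrank_range_add_finrank_ker
  refine ⟨fun heq => ?_, fun heq => ?_⟩
  · rw [heq] at h₁
    omega
  · exact (Submodule.eq_of_le_of_finrank_eq h (by omega)).symm

end Homology

/-- The homology of the differential `f ⊗ v ↦ (x * f) ⊗ e v` on `K ⊗[F] V`. -/
theorem homology_of_tmul [Module.Finite F V] {x : K} (hx : x ≠ 0) {e : V →ₗ[F] V}
    (he : ∀ v, e (e v) = 0) (D : K ⊗[F] V →ₗ[K] K ⊗[F] V)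
    (hD : ∀ f v, D (f ⊗ₜ[F] v) = (x * f) ⊗ₜ[F] e v) :
    (∀ (H : Type) (_ : AddCommGroup H) (_ : Module K H) (π : ker D →ₗ[K] H),
      Function.Surjective π → ker π = (range D).comap (ker D).subtype →
      Module.finrank K H = Module.finrank F V - 2 * Module.finrank F (range e)) ∧
    (ker D = range D ↔ Module.finrank F V = 2 * Module.finrank F (range e)) := by
  have hle := range_le_ker_of_tmul x he D hD
  rw [← finrank_range_of_tmul hx e D hD, ← Module.finrank_baseChange (R := K) (S := F)]
  exact ⟨fun H _ _ π => finrank_homology hle π, ker_eq_range_iff_finrank_eq hle⟩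

end LinearMap

set_option maxHeartbeats 1000000 in
/-- **Unrolled homology of a module with zero differential.**  Here `F = ℤ/2`,
`S = F[ε]` is the ring of dual numbers, `K = LaurentSeries F`.  Let `M` be an `S`-module which
is finite dimensional over `F`, regarded as a differential module with zero differential, so
that the unrolled differential `∂` on `K ⊗[F] M` is determined by `∂(f ⊗ m) = (x·f) ⊗ (ε·m)`.
Then the unrolled homology `ker ∂ ⧸ im ∂` (formalized as any `K`-module `H` together with a
surjection `π : ker ∂ → H` whose kernel is `im ∂`) is a `K`-vector space of dimension
`dim_F M − 2·dim_F(ε·M)`, where `ε·M` is the image of multiplication by `ε`.  In particular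
the unrolled complex of `(M, 0)` is acyclic if and only if `dim_F M = 2·dim_F(ε·M)`. -/
theorem unrolled_homology_of_zero_differential
    (M : Type) [AddCommGroup M] [Module (ZMod 2) M]
    [Module (DualNumber (ZMod 2)) M] [IsScalarTower (ZMod 2) (DualNumber (ZMod 2)) M]
    [Module.Finite (ZMod 2) M]
    (epsM : M →ₗ[ZMod 2] M)
    (hepsM : ∀ m : M, epsM m = (DualNumber.eps : DualNumber (ZMod 2)) • m)
    (D : (LaurentSeries (ZMod 2) ⊗[ZMod 2] M) →ₗ[LaurentSeries (ZMod 2)]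
      (LaurentSeries (ZMod 2) ⊗[ZMod 2] M))
    (hD : ∀ (f : LaurentSeries (ZMod 2)) (m : M),
      D (f ⊗ₜ[ZMod 2] m) =
        ((HahnSeries.single 1 1 : LaurentSeries (ZMod 2)) * f) ⊗ₜ[ZMod 2]
          ((DualNumber.eps : DualNumber (ZMod 2)) • m)) :
    (∀ (H : Type) (_ : AddCommGroup H) (_ : Module (LaurentSeries (ZMod 2)) H)
      (π : ↥(LinearMap.ker D) →ₗ[LaurentSeries (ZMod 2)] H),
      Function.Surjective π →
      LinearMap.ker π = (LinearMap.range D).comap (LinearMap.ker D).subtype →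
      Module.finrank (LaurentSeries (ZMod 2)) H =
        Module.finrank (ZMod 2) M - 2 * Module.finrank (ZMod 2) (LinearMap.range epsM)) ∧
    (LinearMap.ker D = LinearMap.range D ↔
      Module.finrank (ZMod 2) M = 2 * Module.finrank (ZMod 2) (LinearMap.range epsM)) := by
  let _ : Algebra (ZMod 2) (LaurentSeries (ZMod 2)) := HahnSeries.instAlgebra
  have he : ∀ m, epsM (epsM m) = 0 := fun m => by
    rw [hepsM, hepsM, smul_smul, DualNumber.eps_mul_eps, zero_smul]
  exact LinearMap.homology_of_tmul (K := LaurentSeries (ZMod 2)) (x := HahnSeries.single 1 1)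
    (HahnSeries.single_ne_zero one_ne_zero) he D fun f m => by rw [hD, hepsM]
end
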